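/- Let φ be a monotonic nonessential enhancement of site percolation on the square lattice ℤ². Then for every s ∈ [0,1] and every p ∈ [0,1] with θ(p) = 0, also θ(p,s) = 0. Consequently, for every s ∈ [0,1], sup{p ∈ [0,1] : θ(p,s) = 0} = p_c; i.e., the enhancement leaves the critical point unchanged. -/

import Mathlib

open MeasureTheory Filter Set Topology
open scoped ENNReal

namespace PercEnh

/-- Sites of the lattice (vertex set `ℤ²`). -/
abbrev Site : Type := ℤ × ℤ

/-- A configuration: the set of open sites. -/
abbrev Config : Type := Set Site

/-- Square-lattice (`ℤ²`-) adjacency: `‖x − y‖₁ = 1`. -/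
def adjZ2 (x y : Site) : Prop := |x.1 - y.1| + |x.2 - y.2| = 1

/-- Matching (star) adjacency: `x ≠ y` and `‖x − y‖_∞ = 1`. -/
def adjStar (x y : Site) : Prop := x ≠ y ∧ max |x.1 - y.1| |x.2 - y.2| = 1

/-- Euclidean norm of a site. -/
noncomputable def siteNorm (x : Site) : ℝ := Real.sqrt ((x.1 : ℝ) ^ 2 + (x.2 : ℝ) ^ 2)

/-- Sites in the closed Euclidean ball of radius `r` centred at the origin. -/
def siteBall (r : ℝ) : Set Site := {x | siteNorm x ≤ r}

/-- The shifted configuration `τ_x ω = {y − x : y ∈ ω}`. -/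
def shiftConfig (x : Site) (ω : Config) : Config := {y | y + x ∈ ω}

/-- An enhancement function of (finite) range `R₀`: takes values in subsets of
`𝔹₀ = ℤ² ∩ B(R₀)` and depends only on the restriction of the configuration to `𝔹₀`. -/
def IsEnhancement (R₀ : ℝ) (φ : Config → Config) : Prop :=
  0 ≤ R₀ ∧ (∀ ω, φ ω ⊆ siteBall R₀) ∧
    ∀ ω ω' : Config, ω ∩ siteBall R₀ = ω' ∩ siteBall R₀ → φ ω = φ ω'

/-- A monotonic enhancement function. -/
def Monotonic (φ : Config → Config) : Prop := ∀ ω ω' : Config, ω ⊆ ω' → φ ω ⊆ φ ω'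

/-- The translate `φ_x(ω) = x + φ₀(τ_x ω)`. -/
def enhAt (φ : Config → Config) (x : Site) (ω : Config) : Config :=
  (fun z => z + x) '' φ (shiftConfig x ω)

/-- The enhanced configuration `ω̂(ω, α) = ω ∪ ⋃_{x : α(x)=1} φ_x(ω)`. -/
def enhanced (φ : Config → Config) (ω : Config) (α : Site → Bool) : Config :=
  ω ∪ {y | ∃ x, α x = true ∧ y ∈ enhAt φ x ω}

/-- The fully (deterministically, with `s = 1`) enhanced configuration `ω̃`. -/
def fullyEnhanced (φ : Config → Config) (ω : Config) : Config :=
  ω ∪ {y | ∃ x, y ∈ enhAt φ x ω}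

/-- `ω` contains a doubly-infinite self-repelling path (w.r.t. adjacency `adj`):
a two-sided sequence of distinct sites of `ω` in which exactly the consecutive
pairs are adjacent. -/
def HasDISRPath (adj : Site → Site → Prop) (ω : Config) : Prop :=
  ∃ γ : ℤ → Site, Function.Injective γ ∧ (∀ i, γ i ∈ ω) ∧
    ∀ i j : ℤ, adj (γ i) (γ j) ↔ (j = i + 1 ∨ i = j + 1)

/-- The enhancement is essential: some configuration without a doubly-infinite
self-repelling path acquires one upon enhancement at the origin. -/
def Essential (adj : Site → Site → Prop) (φ : Config → Config) : Prop :=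
  ∃ ω : Config, ¬ HasDISRPath adj ω ∧ HasDISRPath adj (ω ∪ φ ω)

/-- A (finite, nonempty) path w.r.t. adjacency `adj`: distinct sites,
consecutive ones adjacent. -/
def IsPathOn (adj : Site → Site → Prop) (l : List Site) : Prop :=
  l ≠ [] ∧ l.Nodup ∧ l.Chain' adj

/-- `x` and `y` are joined by a path of sites of `ω`. -/
def ConnectedIn (adj : Site → Site → Prop) (ω : Config) (x y : Site) : Prop :=
  ∃ l : List Site, IsPathOn adj l ∧ (∀ z ∈ l, z ∈ ω) ∧
    l.head? = some x ∧ l.getLast? = some y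

/-- `x` belongs to an infinite open cluster of `ω`. -/
def InInfiniteCluster (adj : Site → Site → Prop) (ω : Config) (x : Site) : Prop :=
  {y | ConnectedIn adj ω x y}.Infinite

/-- `ω` contains an infinite open cluster. -/
def HasInfiniteCluster (adj : Site → Site → Prop) (ω : Config) : Prop :=
  ∃ x, InInfiniteCluster adj ω x

/-- The configuration corresponding to `η : Site → Bool`. -/
def toConfig (η : Site → Bool) : Config := {x | η x = true}

/-- A cylinder event. -/
def cylinder (F : Finset Site) (b : Site → Bool) : Set (Site → Bool) :=
  {η | ∀ x ∈ F, η x = b x}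

/-- `μ` is the Bernoulli product measure with density `p` of open sites. -/
def IsBernoulli (p : ℝ) (μ : Measure (Site → Bool)) : Prop :=
  IsProbabilityMeasure μ ∧
    ∀ (F : Finset Site) (b : Site → Bool),
      μ (cylinder F b) = ∏ x ∈ F, ENNReal.ofReal (if b x then p else 1 - p)

/-- The percolation probability `θ`: the probability that the origin lies in an
infinite open cluster. -/
noncomputable def theta (adj : Site → Site → Prop) (μ : Measure (Site → Bool)) : ℝ :=
  (μ {η | InInfiniteCluster adj (toConfig η) 0}).toReal

/-- The percolation probability of the enhanced process (`μ` the law of the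
configuration, `ν` the law of the activation variables). -/
noncomputable def thetaEnh (adj : Site → Site → Prop) (φ : Config → Config)
    (μ ν : Measure (Site → Bool)) : ℝ :=
  ((μ.prod ν) {ηα | InInfiniteCluster adj (enhanced φ (toConfig ηα.1) ηα.2) 0}).toReal

/-- The critical point `p_c = sup {p ∈ [0,1] : θ(p) = 0}` for the family `P`. -/
noncomputable def pcOf (adj : Site → Site → Prop) (P : ℝ → Measure (Site → Bool)) : ℝ :=
  sSup {p | p ∈ Icc (0:ℝ) 1 ∧ theta adj (P p) = 0}

/-- The connectivity function `τ_p(x)`. -/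
noncomputable def tau (adj : Site → Site → Prop) (μ : Measure (Site → Bool)) (x : Site) : ℝ :=
  (μ {η | ConnectedIn adj (toConfig η) 0 x}).toReal

/-- The connectivity function `τ_{p,s}(x)` of the enhanced process. -/
noncomputable def tauEnh (adj : Site → Site → Prop) (φ : Config → Config)
    (μ ν : Measure (Site → Bool)) (x : Site) : ℝ :=
  ((μ.prod ν) {ηα | ConnectedIn adj (enhanced φ (toConfig ηα.1) ηα.2) 0 x}).toReal

/-- The mean cluster size `χ(p) = E_p‖C‖ = ∑_x τ_p(x)`. -/
noncomputable def chi (adj : Site → Site → Prop) (μ : Measure (Site → Bool)) : ℝ≥0∞ :=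
  ∑' x : Site, μ {η | ConnectedIn adj (toConfig η) 0 x}

/-- The mean cluster size of the enhanced process. -/
noncomputable def chiEnh (adj : Site → Site → Prop) (φ : Config → Config)
    (μ ν : Measure (Site → Bool)) : ℝ≥0∞ :=
  ∑' x : Site, (μ.prod ν) {ηα | ConnectedIn adj (enhanced φ (toConfig ηα.1) ηα.2) 0 x}


/-! ### Open connections -/

/-- Adjacency of two open sites. -/
def openAdj (ω : Config) (a b : Site) : Prop := adjZ2 a b ∧ a ∈ ω ∧ b ∈ ω

/-- `a = b`, or `a` and `b` are joined by an open path. -/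
def Joined (ω : Config) : Site → Site → Prop := Relation.ReflTransGen (openAdj ω)

lemma adjZ2_comm {x y : Site} : adjZ2 x y ↔ adjZ2 y x := by
  simp only [adjZ2, abs_eq_max_neg]; omega

lemma adjZ2_irrefl (x : Site) : ¬ adjZ2 x x := by simp [adjZ2]

lemma openAdj.symm {ω : Config} {a b : Site} (h : openAdj ω a b) : openAdj ω b a :=
  ⟨adjZ2_comm.1 h.1, h.2.2, h.2.1⟩

lemma openAdj.mono {ω ω' : Config} (hω : ω ⊆ ω') {a b : Site} (h : openAdj ω a b) :
    openAdj ω' a b :=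
  ⟨h.1, hω h.2.1, hω h.2.2⟩

lemma Joined.mono {ω ω' : Config} (hω : ω ⊆ ω') {a b : Site} (h : Joined ω a b) :
    Joined ω' a b :=
  Relation.ReflTransGen.mono (r := openAdj ω) (p := openAdj ω') (fun _ _ => openAdj.mono hω) _ _ h

lemma Joined.symm {ω : Config} {a b : Site} (h : Joined ω a b) : Joined ω b a := by
  induction h with
  | refl => exact .refl
  | tail _ h ih => exact .head h.symm ih

lemma Joined.mem_of_mem {ω : Config} {a b : Site} (h : Joined ω a b) (ha : a ∈ ω) : b ∈ ω := by
  induction h with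
  | refl => exact ha
  | tail _ h _ => exact h.2.2

/-- The subgraph of the square lattice spanned by the open sites. -/
def openGraph (ω : Config) : SimpleGraph Site where
  Adj := openAdj ω
  symm := ⟨fun _ _ => openAdj.symm⟩
  loopless := ⟨fun x h => adjZ2_irrefl x h.1⟩

lemma openGraph_reachable_iff {ω : Config} {a b : Site} :
    (openGraph ω).Reachable a b ↔ Joined ω a b :=
  SimpleGraph.reachable_iff_reflTransGen a b

lemma ConnectedIn.mem {ω : Config} {x y : Site} (h : ConnectedIn adjZ2 ω x y) : x ∈ ω := by
  obtain ⟨l, -, hl, hx, -⟩ := h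
  exact hl x (List.mem_of_mem_head? (by simp [hx]))

lemma ConnectedIn.mono {ω ω' : Config} (hω : ω ⊆ ω') {x y : Site}
    (h : ConnectedIn adjZ2 ω x y) : ConnectedIn adjZ2 ω' x y := by
  obtain ⟨l, hp, hl, hx, hy⟩ := h
  exact ⟨l, hp, fun z hz => hω (hl z hz), hx, hy⟩

lemma ConnectedIn.joined {ω : Config} {x y : Site} (h : ConnectedIn adjZ2 ω x y) :
    Joined ω x y := by
  obtain ⟨l, ⟨-, -, hc⟩, hl, hx, hy⟩ := h
  induction l generalizing x with
  | nil => simp at hx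
  | cons a l ih =>
    obtain rfl : a = x := by simpa using hx
    cases l with
    | nil =>
      obtain rfl : a = y := by simpa using hy
      exact .refl
    | cons b l =>
      rw [List.Chain', List.isChain_cons_cons] at hc
      refine .head ⟨hc.1, hl a (by simp), hl b (by simp)⟩
        (ih hc.2 (fun z hz => hl z (List.mem_cons_of_mem _ hz)) rfl ?_)
      simpa using hy

lemma Joined.connectedIn {ω : Config} {x y : Site} (h : Joined ω x y) (hx : x ∈ ω) :
    ConnectedIn adjZ2 ω x y := by
  classical
  obtain ⟨p, hp⟩ := (openGraph_reachable_iff.2 h).exists_isPath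
  refine ⟨p.support, ⟨p.support_ne_nil, hp.support_nodup, ?_⟩, fun z hz => ?_, ?_, ?_⟩
  · exact p.isChain_adj_support.imp fun _ _ h => h.1
  · exact (openGraph_reachable_iff.1 ⟨p.takeUntil z hz⟩).mem_of_mem hx
  · rw [List.head?_eq_some_head p.support_ne_nil, p.head_support]
  · rw [List.getLast?_eq_some_getLast p.support_ne_nil, p.getLast_support]

/-- An open connection can be realised by an open self-repelling path. -/
lemma Joined.exists_selfRepelling {ω : Config} {x y : Site} (h : Joined ω x y) :
    ∃ (n : ℕ) (w : ℕ → Site), w 0 = x ∧ w n = y ∧ (∀ i < n, openAdj ω (w i) (w (i + 1))) ∧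
      ∀ i j, i < j → j ≤ n → adjZ2 (w i) (w j) → j = i + 1 := by
  obtain ⟨p, hp⟩ := (openGraph_reachable_iff.2 h).exists_walk_length_eq_dist
  have hadj : ∀ i < p.length, openAdj ω (p.getVert i) (p.getVert (i + 1)) :=
    fun i hi => p.adj_getVert_succ hi
  refine ⟨p.length, p.getVert, p.getVert_zero, p.getVert_length, hadj, fun i j hij hj ha => ?_⟩
  have h1 : p.getVert i ∈ ω := (hadj i (by omega)).2.1
  have h2 : p.getVert j ∈ ω := by
    have := (hadj (j - 1) (by omega)).2.2
    rwa [show j - 1 + 1 = j by omega] at this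
  have ha' : (openGraph ω).Adj (p.getVert i) (p.getVert j) := ⟨ha, h1, h2⟩
  have := SimpleGraph.dist_le ((p.take i).append (.cons ha' (p.drop j)))
  simp only [SimpleGraph.Walk.length_append, SimpleGraph.Walk.length_cons,
    SimpleGraph.Walk.take_length, SimpleGraph.Walk.drop_length] at this
  omega

/-! ### Boxes and rays -/

/-- The `ℓ^∞` norm of a site. -/
def supNorm (x : Site) : ℤ := max |x.1| |x.2|

/-- The sites of `ℓ^∞` norm at most `r`. -/
def box (r : ℤ) : Set Site := {x | supNorm x ≤ r}

lemma finite_box (r : ℤ) : (box r).Finite := by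
  refine ((Set.finite_Icc (-r) r).prod (Set.finite_Icc (-r) r)).subset fun x hx => ?_
  simp only [box, supNorm, Set.mem_ofPred_eq, max_le_iff, abs_le] at hx
  simp only [Set.mem_prod, Set.mem_Icc]
  omega

lemma exists_subset_box {s : Set Site} (hs : s.Finite) : ∃ r, s ⊆ box r := by
  obtain ⟨r, hr⟩ := (hs.image supNorm).bddAbove
  exact ⟨r, fun x hx => hr ⟨x, hx, rfl⟩⟩

lemma supNorm_le_of_adjZ2 {x y : Site} (h : adjZ2 x y) : supNorm y ≤ supNorm x + 1 := by
  simp only [adjZ2, supNorm, abs_eq_max_neg] at *; omega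

lemma supNorm_sub_comm (x y : Site) : supNorm (x - y) = supNorm (y - x) := by
  simp only [supNorm, Prod.fst_sub, Prod.snd_sub, abs_sub_comm]

lemma supNorm_add_le (x y : Site) : supNorm (x + y) ≤ supNorm x + supNorm y := by
  simp only [supNorm, Prod.fst_add, Prod.snd_add, abs_eq_max_neg]; omega

lemma supNorm_le_siteNorm (x : Site) : ((supNorm x : ℤ) : ℝ) ≤ siteNorm x := by
  simp only [supNorm, siteNorm, Int.cast_max, Int.cast_abs, max_le_iff]
  exact ⟨Real.abs_le_sqrt (by nlinarith [sq_nonneg (x.2 : ℝ)]),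
    Real.abs_le_sqrt (by nlinarith [sq_nonneg (x.1 : ℝ)])⟩

lemma supNorm_lt_of_mem_siteBall {R : ℝ} {r : ℤ} (hR : R + 1 ≤ r) {x : Site}
    (hx : x ∈ siteBall R) : supNorm x < r := by
  have h₁ := supNorm_le_siteNorm x
  have h₂ : siteNorm x ≤ R := hx
  exact_mod_cast (show ((supNorm x : ℤ) : ℝ) < r by linarith)

/-- The `k`-th site of the straight ray from `y`, a site on the boundary of `box r`, to infinity
which leaves the box at once. -/
def ray (r : ℤ) (y : Site) (k : ℤ) : Site :=
  if y.1 = r then (y.1 + k, y.2) else if y.1 = -r then (y.1 - k, y.2)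
  else if y.2 = r then (y.1, y.2 + k) else (y.1, y.2 - k)

section Ray

variable {r : ℤ} {y z : Site}

lemma supNorm_ray (hr : 1 ≤ r) (hy : supNorm y = r) {k : ℤ} (hk : 0 ≤ k) :
    supNorm (ray r y k) = r + k := by
  simp only [supNorm, ray, abs_eq_max_neg] at *; split_ifs <;> dsimp only <;> omega

lemma adjZ2_ray_ray {k l : ℤ} : adjZ2 (ray r y k) (ray r y l) ↔ l = k + 1 ∨ k = l + 1 := by
  simp only [adjZ2, ray, abs_eq_max_neg]; split_ifs <;> dsimp only <;> omega

lemma adjZ2_ray_iff (hr : 1 ≤ r) (hy : supNorm y = r) {x : Site} (hx : supNorm x ≤ r) {k : ℤ}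
    (hk : 1 ≤ k) : adjZ2 x (ray r y k) ↔ k = 1 ∧ x = y := by
  simp only [adjZ2, supNorm, ray, abs_eq_max_neg, Prod.ext_iff] at *
  split_ifs <;> dsimp only <;> omega

lemma not_adjZ2_ray_ray (hr : 1 ≤ r) (hy : supNorm y = r) (hz : supNorm z = r) (hne : y ≠ z)
    (hadj : ¬ adjZ2 y z) {k l : ℤ} (hk : 1 ≤ k) (hl : 1 ≤ l) :
    ¬ adjZ2 (ray r y k) (ray r z l) := by
  obtain ⟨a, b⟩ := y
  obtain ⟨c, d⟩ := z
  have h₁ : a = c → 2 ≤ |b - d| := by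
    rintro rfl
    simp only [adjZ2, Ne, Prod.mk.injEq, true_and, sub_self, abs_zero] at hne hadj
    simp only [abs_eq_max_neg] at *
    omega
  have h₂ : b = d → 2 ≤ |a - c| := by
    rintro rfl
    simp only [adjZ2, Ne, Prod.mk.injEq, and_true, sub_self, abs_zero] at hne hadj
    simp only [abs_eq_max_neg] at *
    omega
  have hy' : a ≤ r ∧ -r ≤ a ∧ b ≤ r ∧ -r ≤ b ∧ (a = r ∨ a = -r ∨ b = r ∨ b = -r) := by
    simp only [supNorm, abs_eq_max_neg] at hy; omega
  have hz' : c ≤ r ∧ -r ≤ c ∧ d ≤ r ∧ -r ≤ d ∧ (c = r ∨ c = -r ∨ d = r ∨ d = -r) := by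
    simp only [supNorm, abs_eq_max_neg] at hz; omega
  clear hy hz hne hadj
  intro h
  suffices 2 ≤ |(ray r (a, b) k).1 - (ray r (c, d) l).1| +
      |(ray r (a, b) k).2 - (ray r (c, d) l).2| by
    rw [adjZ2] at h; omega
  clear h
  simp only [ray]
  split_ifs <;> dsimp only <;> first
    | exact le_add_of_nonneg_of_le (abs_nonneg _) (h₁ (by omega))
    | exact le_add_of_le_of_nonneg (h₂ (by omega)) (abs_nonneg _)
    | (clear h₁ h₂; simp only [abs_eq_max_neg]; omega)

end Ray

/-! ### An enhancement inside a box -/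

lemma exists_eq_of_step_le {f : ℕ → ℤ} (hf : ∀ i, f (i + 1) ≤ f i + 1) {K : ℤ} (h0 : f 0 < K)
    (hK : ∃ n, K ≤ f n) : ∃ n, 0 < n ∧ f n = K := by
  classical
  have hn := Nat.find_spec hK
  have hpos : 0 < Nat.find hK := by
    refine Nat.pos_of_ne_zero fun h => ?_
    rw [h] at hn
    omega
  have hlt := Nat.find_min hK (Nat.sub_lt hpos one_pos)
  have hs := hf (Nat.find hK - 1)
  rw [Nat.sub_add_cancel hpos] at hs
  exact ⟨_, hpos, by omega⟩

/-- A doubly-infinite path leaves every box at both ends, so it cannot meet all large spheres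
in at most one site. -/
lemma exists_ne_supNorm_eq {γ : ℤ → Site} (hγ : Function.Injective γ)
    (hadj : ∀ i, adjZ2 (γ i) (γ (i + 1))) (r : ℤ) :
    ∃ i j, i ≠ j ∧ r < supNorm (γ i) ∧ supNorm (γ i) = supNorm (γ j) := by
  have hunb : ∀ g : ℕ → ℤ, Function.Injective g → ∀ K, ∃ n, K ≤ supNorm (γ (g n)) := by
    intro g hg K
    by_contra! h
    exact Set.infinite_univ (((finite_box K).preimage (hγ.comp hg).injOn).subset
      fun n _ => (h n).le)
  set K := max r (supNorm (γ 0)) + 1 with hK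
  obtain ⟨m, hm, hm'⟩ := exists_eq_of_step_le (f := fun n : ℕ => supNorm (γ n)) (K := K)
    (fun n => by simpa using supNorm_le_of_adjZ2 (hadj n)) (by simp only [Nat.cast_zero]; omega)
    (hunb _ Nat.cast_injective K)
  obtain ⟨n, hn, hn'⟩ := exists_eq_of_step_le (f := fun n : ℕ => supNorm (γ (-n))) (K := K)
    (fun n => by
      have := supNorm_le_of_adjZ2 (adjZ2_comm.1 (hadj (-((n + 1 : ℕ) : ℤ))))
      rwa [show -((n + 1 : ℕ) : ℤ) + 1 = -(n : ℤ) by push_cast; ring] at this)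
    (by simp only [Nat.cast_zero, neg_zero]; omega)
    (hunb _ (neg_injective.comp Nat.cast_injective) K)
  exact ⟨m, -n, by omega, by omega, hm'.trans hn'.symm⟩

lemma hasDISRPath_of_adj_iff {ω : Config} {γ : ℤ → Site} (hω : ∀ i, γ i ∈ ω)
    (hγ : ∀ i j, i < j → (adjZ2 (γ i) (γ j) ↔ j = i + 1)) : HasDISRPath adjZ2 ω := by
  have key : ∀ i j, adjZ2 (γ i) (γ j) ↔ (j = i + 1 ∨ i = j + 1) := by
    intro i j
    rcases lt_trichotomy i j with h | rfl | h
    · rw [hγ i j h]; omega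
    · simp [adjZ2_irrefl]
    · rw [adjZ2_comm, hγ j i h]; omega
  refine ⟨γ, fun i j hij => ?_, hω, key⟩
  have h₁ := (key i (i + 1)).2 (.inl rfl)
  have h₂ := (key i (i - 1)).2 (.inr (by omega))
  rw [hij, key] at h₁ h₂
  omega

section Local

variable {r : ℤ} {y z : Site}

/-- The part of `η` in `box r`, together with the rays from `y` and `z` to infinity. -/
def withRays (r : ℤ) (y z : Site) (η : Config) : Config :=
  (η ∩ box r) ∪ {x | ∃ k, 1 ≤ k ∧ (x = ray r y k ∨ x = ray r z k)}

lemma hasDISRPath_withRays (hr : 1 ≤ r) (hy : supNorm y = r) (hz : supNorm z = r) (hne : y ≠ z)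
    (hadj : ¬ adjZ2 y z) {η : Config} (h : Joined (η ∩ box r) y z) :
    HasDISRPath adjZ2 (withRays r y z η) := by
  obtain ⟨n, w, rfl, rfl, hw, hw'⟩ := h.exists_selfRepelling
  have hn : 0 < n := Nat.pos_of_ne_zero fun h => hne (by rw [h])
  have hmem : ∀ i ≤ n, w i ∈ η ∩ box r := by
    intro i hi
    rcases hi.lt_or_eq with h | rfl
    · exact (hw i h).2.1
    · have := (hw (i - 1) (by omega)).2.2
      rwa [Nat.sub_add_cancel hn] at this
  have hinj : ∀ i j, i < j → j ≤ n → w i ≠ w j := by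
    intro i j hij hj heq
    rcases hj.lt_or_eq with h | rfl
    · have := hw' i (j + 1) (by omega) (by omega) (heq ▸ (hw j h).1)
      omega
    · rcases i with _ | i
      · exact hne heq
      · have := hw' i j (by omega) le_rfl (heq ▸ (hw i (by omega)).1)
        omega
  let γ : ℤ → Site := fun i =>
    if i < 0 then ray r (w 0) (-i) else if i ≤ n then w i.toNat else ray r (w n) (i - n)
  have hγ₁ : ∀ i : ℤ, i < 0 → γ i = ray r (w 0) (-i) := fun i hi => if_pos hi
  have hγ₂ : ∀ i : ℤ, 0 ≤ i → i ≤ n → γ i = w i.toNat := fun i hi hi' => by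
    simp only [γ, if_neg (not_lt.2 hi), if_pos hi']
  have hγ₃ : ∀ i : ℤ, n < i → γ i = ray r (w n) (i - n) := fun i hi => by
    simp only [γ, if_neg (show ¬ i < 0 by omega), if_neg (not_le.2 hi)]
  refine hasDISRPath_of_adj_iff (γ := γ) (fun i => ?_) (fun i j hij => ?_)
  · rcases lt_or_ge i 0 with hi | hi
    · rw [hγ₁ i hi]
      exact .inr ⟨-i, by omega, .inl rfl⟩
    · rcases le_or_gt i n with hi' | hi'
      · rw [hγ₂ i hi hi']
        exact .inl (hmem _ (by omega))
      · rw [hγ₃ i hi']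
        exact .inr ⟨i - n, by omega, .inr rfl⟩
  · rcases lt_or_ge i 0 with hi | hi
    · rw [hγ₁ i hi]
      rcases lt_or_ge j 0 with hj | hj
      · rw [hγ₁ j hj, adjZ2_ray_ray]; omega
      · rcases le_or_gt j n with hj' | hj'
        · rw [hγ₂ j hj hj', adjZ2_comm, adjZ2_ray_iff hr hy (hmem _ (by omega)).2 (by omega)]
          constructor
          · rintro ⟨h1, h2⟩
            by_contra h3
            exact hinj 0 j.toNat (by omega) (by omega) h2.symm
          · intro h1
            rw [show j = 0 by omega]
            exact ⟨by omega, rfl⟩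
        · rw [hγ₃ j hj']
          exact iff_of_false (not_adjZ2_ray_ray hr hy hz hne hadj (by omega) (by omega))
            (by omega)
    · rcases le_or_gt i n with hi' | hi'
      · rw [hγ₂ i hi hi']
        rcases le_or_gt j n with hj' | hj'
        · rw [hγ₂ j (by omega) hj']
          constructor
          · intro h
            have := hw' _ _ (by omega) (by omega) h
            omega
          · intro h
            rw [show j.toNat = i.toNat + 1 by omega]
            exact (hw _ (by omega)).1
        · rw [hγ₃ j hj', adjZ2_ray_iff hr hz (hmem _ (by omega)).2 (by omega)]
          constructor
          · rintro ⟨h1, h2⟩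
            by_contra h3
            exact hinj i.toNat n (by omega) le_rfl h2
          · intro h1
            exact ⟨by omega, by rw [show i.toNat = n by omega]⟩
      · rw [hγ₃ i hi', hγ₃ j (by omega), adjZ2_ray_ray]; omega

lemma joined_of_hasDISRPath_withRays (hr : 1 ≤ r) (hy : supNorm y = r) (hz : supNorm z = r)
    (hne : y ≠ z) (hadj : ¬ adjZ2 y z) {η : Config}
    (h : HasDISRPath adjZ2 (withRays r y z η)) : Joined (η ∩ box r) y z := by
  by_contra hyz
  obtain ⟨γ, hinj, hmem, hγ⟩ := h
  have hstep : ∀ i, adjZ2 (γ i) (γ (i + 1)) := fun i => (hγ _ _).2 (.inl rfl)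
  set A : Set Site := {x | x ∈ η ∩ box r ∧ Joined (η ∩ box r) y x}
  set S : Set Site := A ∪ {x | ∃ k, 1 ≤ k ∧ x = ray r y k}
  have hclosed : ∀ a b, adjZ2 a b → b ∈ withRays r y z η → a ∈ S → b ∈ S := by
    rintro a b hab (hb | ⟨k, hk, rfl | rfl⟩) (⟨ha, hya⟩ | ⟨l, hl, rfl⟩)
    · exact .inl ⟨hb, hya.tail ⟨hab, ha, hb⟩⟩
    · obtain ⟨-, rfl⟩ := (adjZ2_ray_iff hr hy hb.2 hl).1 (adjZ2_comm.1 hab)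
      exact .inl ⟨hb, .refl⟩
    · exact .inr ⟨k, hk, rfl⟩
    · exact .inr ⟨k, hk, rfl⟩
    · obtain ⟨-, rfl⟩ := (adjZ2_ray_iff hr hz ha.2 hk).1 hab
      exact absurd hya hyz
    · exact absurd hab (not_adjZ2_ray_ray hr hy hz hne hadj hl hk)
  have hiff : ∀ i, γ i ∈ S ↔ γ (i + 1) ∈ S := fun i =>
    ⟨hclosed _ _ (hstep i) (hmem _), hclosed _ _ (adjZ2_comm.1 (hstep i)) (hmem _)⟩
  have hall : ∀ i, γ i ∈ S ↔ γ 0 ∈ S := by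
    intro i
    induction i with
    | zero => rfl
    | succ i ih => rw [← hiff, ih]
    | pred i ih => rw [hiff, sub_add_cancel, ih]
  obtain ⟨i, j, hij, hi, heq⟩ := exists_ne_supNorm_eq hinj hstep r
  have hout : ∃ w, supNorm w = r ∧ ∀ i, r < supNorm (γ i) → ∃ k, 1 ≤ k ∧ γ i = ray r w k := by
    have hbox : ∀ i, r < supNorm (γ i) → γ i ∉ η ∩ box r := fun i hi h =>
      absurd h.2 (not_le.2 hi)
    by_cases h0 : γ 0 ∈ S
    · refine ⟨y, hy, fun i hi => ?_⟩
      rcases (hall i).2 h0 with h | h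
      · exact absurd h.1 (hbox i hi)
      · exact h
    · refine ⟨z, hz, fun i hi => ?_⟩
      rcases hmem i with h | ⟨k, hk, h | h⟩
      · exact absurd h (hbox i hi)
      · exact absurd ((hall i).1 (.inr ⟨k, hk, h⟩)) h0
      · exact ⟨k, hk, h⟩
  obtain ⟨w, hw, hout⟩ := hout
  obtain ⟨k, hk, hik⟩ := hout i hi
  obtain ⟨l, hl, hjl⟩ := hout j (heq ▸ hi)
  refine hij (hinj ?_)
  rw [hik, hjl, supNorm_ray hr hw (by omega), supNorm_ray hr hw (by omega)] at heq
  rw [hik, hjl, show k = l by omega]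

end Local

variable {φ : Config → Config} {R₀ : ℝ} {r : ℤ}

/-- A nonessential enhancement does not join boundary sites of a box around it. -/
lemma joined_inter_box (hφ : IsEnhancement R₀ φ) (hness : ¬ Essential adjZ2 φ)
    (hR : R₀ + 1 ≤ r) (η : Config) {y z : Site} (hy : supNorm y = r) (hz : supNorm z = r)
    (h : Joined ((η ∪ φ η) ∩ box r) y z) : Joined (η ∩ box r) y z := by
  obtain ⟨hR₀, hsub, hloc⟩ := hφ
  have hr : 1 ≤ r := by exact_mod_cast (show (1 : ℝ) ≤ r by linarith)
  have hball : ∀ x ∈ siteBall R₀, supNorm x < r := fun x => supNorm_lt_of_mem_siteBall hR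
  have hbd : ∀ x, supNorm x = r → x ∈ (η ∪ φ η) ∩ box r → x ∈ η ∩ box r := by
    rintro x hx ⟨h | h, hb⟩
    · exact ⟨h, hb⟩
    · exact absurd (hball x (hsub _ h)) (by omega)
  rcases eq_or_ne y z with rfl | hne
  · exact .refl
  have hymem : y ∈ η ∩ box r := by
    refine hbd y hy ?_
    rcases Relation.ReflTransGen.cases_head h with h | ⟨_, h, -⟩
    · exact absurd h hne
    · exact h.2.1
  have hzmem : z ∈ η ∩ box r := by
    refine hbd z hz ?_
    rcases Relation.ReflTransGen.cases_tail h with h | ⟨_, -, h⟩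
    · exact absurd h.symm hne
    · exact h.2.2
  by_cases hadj : adjZ2 y z
  · exact .single ⟨hadj, hymem, hzmem⟩
  refine joined_of_hasDISRPath_withRays hr hy hz hne hadj (by_contra fun hno => hness ?_)
  refine ⟨_, hno, ?_⟩
  have hagree : φ (withRays r y z η) = φ η := by
    refine hloc _ _ (Set.ext fun x => ⟨?_, ?_⟩)
    · rintro ⟨h | ⟨k, hk, h⟩, hx⟩
      · exact ⟨h.1, hx⟩
      · have h₁ := hball x hx
        have h₂ : supNorm x = r + k := by
          rcases h with rfl | rfl
          · exact supNorm_ray hr hy (by omega)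
          · exact supNorm_ray hr hz (by omega)
        omega
    · rintro ⟨h, hx⟩
      exact ⟨.inl ⟨h, (hball x hx).le⟩, hx⟩
  rw [hagree]
  obtain ⟨γ, hinj, hmem, hγ⟩ := hasDISRPath_withRays hr hy hz hne hadj h
  refine ⟨γ, hinj, fun i => ?_, hγ⟩
  rcases hmem i with ⟨h | h, hb⟩ | h
  · exact .inl (.inl ⟨h, hb⟩)
  · exact .inr h
  · exact .inl (.inr h)

/-- A nonessential enhancement at the origin does not join sites far from the origin. -/
lemma joined_of_joined_union (hφ : IsEnhancement R₀ φ) (hness : ¬ Essential adjZ2 φ)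
    (hR : R₀ + 1 ≤ r) (η : Config) {u v : Site} (hu : r ≤ supNorm u) (hv : r ≤ supNorm v)
    (h : Joined (η ∪ φ η) u v) : Joined η u v := by
  have hout : ∀ x, r ≤ supNorm x → x ∈ η ∪ φ η → x ∈ η := by
    rintro x hx (h | h)
    · exact h
    · exact absurd (supNorm_lt_of_mem_siteBall hR (hφ.2.1 _ h)) (not_lt.2 hx)
  suffices (r ≤ supNorm v ∧ Joined η u v) ∨ (supNorm v < r ∧
      ∃ y, supNorm y = r ∧ Joined η u y ∧ Joined ((η ∪ φ η) ∩ box r) y v) by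
    rcases this with h | h
    · exact h.2
    · omega
  clear hv
  induction h with
  | refl => exact .inl ⟨hu, .refl⟩
  | @tail w w' _ hs ih =>
    have hn := supNorm_le_of_adjZ2 hs.1
    have hn' := supNorm_le_of_adjZ2 (adjZ2_comm.1 hs.1)
    rcases ih with ⟨hw, huw⟩ | ⟨hw, y, hy, huy, hyw⟩
    · rcases le_or_gt r (supNorm w') with hw' | hw'
      · exact .inl ⟨hw', huw.tail ⟨hs.1, hout _ hw hs.2.1, hout _ hw' hs.2.2⟩⟩
      · exact .inr ⟨hw', w, by omega, huw, .single ⟨hs.1,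
          ⟨hs.2.1, show supNorm w ≤ r by omega⟩, hs.2.2, show supNorm w' ≤ r by omega⟩⟩
    · have hyw' := hyw.tail ⟨hs.1, ⟨hs.2.1, show supNorm w ≤ r by omega⟩, hs.2.2,
        show supNorm w' ≤ r by omega⟩
      rcases le_or_gt r (supNorm w') with hw' | hw'
      · exact .inl ⟨hw', huy.trans ((joined_inter_box hφ hness hR η hy (by omega) hyw').mono
          Set.inter_subset_left)⟩
      · exact .inr ⟨hw', y, hy, huy, hyw'⟩

/-! ### Enhancements far from the end points -/

lemma Joined.shift {ω : Config} {a b : Site} (x : Site) (h : Joined ω a b) :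
    Joined (shiftConfig x ω) (a - x) (b - x) := by
  refine Relation.ReflTransGen.lift (r := openAdj ω) (p := openAdj (shiftConfig x ω)) (· - x)
    (fun c d hcd => ⟨?_, ?_, ?_⟩) _ _ h
  · simpa [adjZ2] using hcd.1
  · simpa [shiftConfig] using hcd.2.1
  · simpa [shiftConfig] using hcd.2.2

lemma Joined.of_shift {ω : Config} {a b : Site} (x : Site)
    (h : Joined (shiftConfig x ω) (a - x) (b - x)) : Joined ω a b := by
  have := Relation.ReflTransGen.lift (r := openAdj (shiftConfig x ω)) (p := openAdj ω)
    (· + x) (fun c d hcd => ⟨by simpa [adjZ2] using hcd.1, hcd.2.1, hcd.2.2⟩) _ _ h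
  simpa [Function.onFun, Joined] using this

lemma shiftConfig_union_enhAt (x : Site) (η : Config) :
    shiftConfig x (η ∪ enhAt φ x η) = shiftConfig x η ∪ φ (shiftConfig x η) := by
  ext y
  simp [shiftConfig, enhAt]

lemma joined_of_joined_union_enhAt (hφ : IsEnhancement R₀ φ) (hness : ¬ Essential adjZ2 φ)
    (hR : R₀ + 1 ≤ r) (η : Config) {x u v : Site} (hu : r ≤ supNorm (u - x))
    (hv : r ≤ supNorm (v - x)) (h : Joined (η ∪ enhAt φ x η) u v) : Joined η u v := by
  refine .of_shift x (joined_of_joined_union hφ hness hR _ hu hv ?_)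
  rw [← shiftConfig_union_enhAt]
  exact h.shift x

lemma enhAt_mono (hmono : Monotonic φ) (x : Site) {ω η : Config} (h : ω ⊆ η) :
    enhAt φ x ω ⊆ enhAt φ x η :=
  Set.image_mono (hmono _ _ fun _ hy => h hy)

lemma joined_of_joined_union_finset (hφ : IsEnhancement R₀ φ) (hmono : Monotonic φ)
    (hness : ¬ Essential adjZ2 φ) (hR : R₀ + 1 ≤ r) {ω : Config} {u v : Site} (X : Finset Site)
    (hX : ∀ x ∈ X, r ≤ supNorm (u - x) ∧ r ≤ supNorm (v - x)) {η : Config} (hη : ω ⊆ η)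
    (h : Joined (η ∪ ⋃ x ∈ X, enhAt φ x ω) u v) : Joined η u v := by
  classical
  induction X using Finset.induction_on generalizing η with
  | empty => simpa using h
  | insert x X _ ih =>
    have hx := hX x (Finset.mem_insert_self _ _)
    refine joined_of_joined_union_enhAt hφ hness hR η hx.1 hx.2 (Joined.mono
      (Set.union_subset_union_right _ (enhAt_mono hmono x hη)) (ih
        (fun y hy => hX y (Finset.mem_insert_of_mem hy)) (hη.trans Set.subset_union_left) ?_))
    rwa [Set.union_assoc, ← Finset.set_biUnion_insert x X fun y => enhAt φ y ω]

lemma exists_finset_of_joined_enhanced {ω : Config} {α : Site → Bool} {u v : Site}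
    (h : Joined (enhanced φ ω α) u v) :
    ∃ X : Finset Site, Joined (ω ∪ ⋃ x ∈ X, enhAt φ x ω) u v := by
  classical
  have hmem : ∀ a ∈ enhanced φ ω α, ∃ X : Finset Site, a ∈ ω ∪ ⋃ x ∈ X, enhAt φ x ω := by
    rintro a (ha | ⟨x, -, hx⟩)
    · exact ⟨∅, .inl ha⟩
    · exact ⟨{x}, .inr (by simpa using hx)⟩
  have hsub : ∀ {X Y : Finset Site}, X ⊆ Y →
      (ω ∪ ⋃ x ∈ X, enhAt φ x ω) ⊆ ω ∪ ⋃ x ∈ Y, enhAt φ x ω := fun hXY =>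
    Set.union_subset_union_right _ (Set.biUnion_subset_biUnion_left hXY)
  induction h with
  | refl => exact ⟨∅, .refl⟩
  | @tail b c _ hbc ih =>
    obtain ⟨X, hX⟩ := ih
    obtain ⟨Y, hY⟩ := hmem b hbc.2.1
    obtain ⟨Z, hZ⟩ := hmem c hbc.2.2
    refine ⟨X ∪ (Y ∪ Z), (hX.mono (hsub Finset.subset_union_left)).tail ⟨hbc.1, hsub ?_ hY,
      hsub ?_ hZ⟩⟩
    · exact Finset.subset_union_left.trans Finset.subset_union_right
    · exact Finset.subset_union_right.trans Finset.subset_union_right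

/-! ### Infinite clusters -/

/-- Opening sites near the end points of a path does not extend clusters far away from them. -/
lemma joined_of_eq_away {ω η : Config} {m : ℤ} {v w : Site} (hm : 0 ≤ m)
    (hη : ∀ x ∈ η, x ∈ ω ∨ supNorm x ≤ m ∨ supNorm (v - x) ≤ m) (h : Joined η 0 w) :
    (∃ a ∈ box (m + 1), Joined ω a w) ∨
      ∃ a ∈ box (m + 1), ∃ w', supNorm (v - w') ≤ m + 1 ∧ Joined ω a w' := by
  induction h with
  | refl => exact .inl ⟨0, by simp [box, supNorm]; omega, .refl⟩
  | @tail b c _ hbc ih =>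
    rcases ih with ⟨a, ha, hab⟩ | h
    · have h₁ := supNorm_le_of_adjZ2 hbc.1
      have h₂ : supNorm (v - b) ≤ supNorm (v - c) + 1 :=
        supNorm_le_of_adjZ2 (by
          have := adjZ2_comm.1 hbc.1
          simp only [adjZ2, Prod.fst_sub, Prod.snd_sub, sub_sub_sub_cancel_left] at *
          exact hbc.1)
      rcases hη b hbc.2.1 with hb | hb | hb
      · rcases hη c hbc.2.2 with hc | hc | hc
        · exact .inl ⟨a, ha, hab.tail ⟨hbc.1, hb, hc⟩⟩
        · exact .inl ⟨c, show supNorm c ≤ m + 1 by omega, .refl⟩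
        · exact .inr ⟨a, ha, b, by omega, hab⟩
      · exact .inl ⟨c, show supNorm c ≤ m + 1 by omega, .refl⟩
      · exact .inr ⟨a, ha, b, by omega, hab⟩
    · exact .inr h

lemma finite_joined {ω : Config} {x : Site} (h : ¬ InInfiniteCluster adjZ2 ω x) :
    {y | Joined ω x y}.Finite := by
  by_cases hx : x ∈ ω
  · exact (Set.not_infinite.1 h).subset fun y hy => Joined.connectedIn hy hx
  · refine (Set.finite_singleton x).subset fun y hy => ?_
    rcases Relation.ReflTransGen.cases_head hy with rfl | ⟨_, h, -⟩
    · rfl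
    · exact absurd h.2.1 hx

lemma not_inInfiniteCluster_enhanced (hφ : IsEnhancement R₀ φ) (hmono : Monotonic φ)
    (hness : ¬ Essential adjZ2 φ) {ω : Config} (hω : ¬ HasInfiniteCluster adjZ2 ω)
    (α : Site → Bool) : ¬ InInfiniteCluster adjZ2 (enhanced φ ω α) 0 := by
  classical
  intro hinf
  obtain ⟨r, hR⟩ : ∃ r : ℤ, R₀ + 1 ≤ r := ⟨⌈R₀ + 1⌉, Int.le_ceil _⟩
  have hr : 1 ≤ r := by exact_mod_cast (show (1 : ℝ) ≤ r by linarith [hφ.1])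
  have hfin : (⋃ a ∈ box (2 * r + 1), {y | Joined ω a y}).Finite :=
    (finite_box _).biUnion fun a _ => finite_joined fun h => hω ⟨a, h⟩
  obtain ⟨L, hL⟩ := exists_subset_box hfin
  obtain ⟨v, hv, hvL⟩ := hinf.exists_notMem_finite (finite_box (L + (2 * r + 1)))
  obtain ⟨X, hX⟩ := exists_finset_of_joined_enhanced hv.joined
  set near : Site → Prop := fun x => supNorm x < r ∨ supNorm (v - x) < r
  have hjoin : Joined (ω ∪ ⋃ x ∈ X.filter near, enhAt φ x ω) 0 v := by
    refine joined_of_joined_union_finset hφ hmono hness hR (ω := ω)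
      (X.filter fun x => ¬ near x) (fun x hx => ?_) Set.subset_union_left ?_
    · have := (Finset.mem_filter.1 hx).2
      simp only [near, not_or, not_lt] at this
      rwa [supNorm_sub_comm, sub_zero]
    · rwa [Set.union_assoc, ← Finset.set_biUnion_union, Finset.filter_union_filter_not_eq]
  have hmem : ∀ a ∈ box (2 * r + 1), ∀ y, Joined ω a y → supNorm y ≤ L := fun a ha y hy =>
    hL (Set.mem_biUnion ha hy)
  have hvL' : L + (2 * r + 1) < supNorm v := not_le.1 hvL
  have haway : ∀ x ∈ ω ∪ ⋃ y ∈ X.filter near, enhAt φ y ω,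
      x ∈ ω ∨ supNorm x ≤ 2 * r ∨ supNorm (v - x) ≤ 2 * r := by
    intro x hx
    rcases hx with hx | hx
    · exact .inl hx
    · simp only [Set.mem_iUnion, Finset.mem_filter] at hx
      obtain ⟨c, ⟨-, hc⟩, z, hz, rfl⟩ := hx
      have hz' := supNorm_lt_of_mem_siteBall hR (hφ.2.1 _ hz)
      refine .inr (hc.imp (fun hc => ?_) (fun hc => ?_))
      · have := supNorm_add_le z c
        dsimp only
        omega
      · have h₁ := supNorm_add_le (v - c) (-z)
        have h₂ : supNorm (-z) = supNorm z := by simp [supNorm]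
        rw [show v - c + -z = v - (z + c) by abel] at h₁
        dsimp only
        omega
  rcases joined_of_eq_away (by omega) haway hjoin with ⟨a, ha, hav⟩ | ⟨a, ha, w, hw, haw⟩
  · have := hmem a ha v hav
    omega
  · have h₁ := hmem a ha w haw
    have h₂ := supNorm_add_le (v - w) w
    rw [sub_add_cancel] at h₂
    omega

/-! ### Translation invariance -/

/-- The cylinder events, together with the empty event. -/
def cylinders : Set (Set (Site → Bool)) := {s | s = ∅ ∨ ∃ F b, s = cylinder F b}

lemma isPiSystem_cylinders : IsPiSystem cylinders := by
  classical
  rintro _ (rfl | ⟨F, b, rfl⟩) _ (rfl | ⟨G, c, rfl⟩) hne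
  · exact .inl (by simp)
  · exact .inl (by simp)
  · exact .inl (by simp)
  · obtain ⟨η, hb, hc⟩ := hne
    refine .inr ⟨F ∪ G, η, Set.ext fun ζ => ⟨?_, fun h => ⟨fun x hx => ?_, fun x hx => ?_⟩⟩⟩
    · rintro ⟨h₁, h₂⟩ x hx
      rcases Finset.mem_union.1 hx with hx | hx
      · rw [h₁ x hx, hb x hx]
      · rw [h₂ x hx, hc x hx]
    · rw [h x (Finset.mem_union_left _ hx), hb x hx]
    · rw [h x (Finset.mem_union_right _ hx), hc x hx]

lemma measurableSet_cylinder (F : Finset Site) (b : Site → Bool) :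
    MeasurableSet (cylinder F b) := by
  have : cylinder F b = ⋂ x ∈ F, (fun η : Site → Bool => η x) ⁻¹' {b x} := by
    ext η
    simp [cylinder]
  rw [this]
  exact Finset.measurableSet_biInter _ fun x _ => measurable_pi_apply x (measurableSet_singleton _)

lemma generateFrom_cylinders :
    (MeasurableSpace.pi : MeasurableSpace (Site → Bool)) =
      MeasurableSpace.generateFrom cylinders := by
  refine le_antisymm (iSup_le fun x => ?_) (MeasurableSpace.generateFrom_le ?_)
  · rw [← measurable_iff_comap_le]
    let _ := MeasurableSpace.generateFrom cylinders
    refine measurable_to_countable' fun c =>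
      MeasurableSpace.measurableSet_generateFrom (Or.inr ⟨{x}, fun _ => c, ?_⟩)
    ext η
    simp [cylinder]
  · rintro _ (rfl | ⟨F, b, rfl⟩)
    · exact .empty
    · exact measurableSet_cylinder F b

lemma IsBernoulli.unique {p : ℝ} {μ ν : Measure (Site → Bool)} (hμ : IsBernoulli p μ)
    (hν : IsBernoulli p ν) : μ = ν := by
  have := hμ.1
  have := hν.1
  refine ext_of_generate_finite cylinders generateFrom_cylinders isPiSystem_cylinders ?_ (by simp)
  rintro _ (rfl | ⟨F, b, rfl⟩)
  · simp
  · rw [hμ.2, hν.2]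

/-- Translation by `x` of `Bool`-valued fields. -/
def translate (x : Site) : (Site → Bool) ≃ᵐ (Site → Bool) where
  toFun η y := η (y + x)
  invFun η y := η (y - x)
  left_inv η := by ext y; simp
  right_inv η := by ext y; simp
  measurable_toFun := measurable_pi_lambda _ fun y => measurable_pi_apply (y + x)
  measurable_invFun := measurable_pi_lambda _ fun y => measurable_pi_apply (y - x)

lemma IsBernoulli.map_translate {p : ℝ} {μ : Measure (Site → Bool)} (hμ : IsBernoulli p μ)
    (x : Site) : μ.map (translate x) = μ := by
  classical
  have := hμ.1
  refine IsBernoulli.unique (p := p)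
    ⟨Measure.isProbabilityMeasure_map (translate x).measurable.aemeasurable, fun F b => ?_⟩ hμ
  have : translate x ⁻¹' cylinder F b =
      cylinder (F.map (Equiv.addRight x).toEmbedding) (fun y => b (y - x)) := by
    ext η
    refine ⟨fun h y hy => ?_, fun h y hy => ?_⟩
    · obtain ⟨z, hz, rfl⟩ := Finset.mem_map.1 hy
      simpa [translate] using h z hz
    · simpa [translate] using h (y + x) (Finset.mem_map.2 ⟨y, hy, rfl⟩)
  rw [MeasurableEquiv.map_apply, this, hμ.2]
  simp

lemma inInfiniteCluster_shiftConfig {ω : Config} {x : Site} (h : InInfiniteCluster adjZ2 ω x) :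
    InInfiniteCluster adjZ2 (shiftConfig x ω) 0 := by
  refine (h.image (f := (· - x)) (sub_left_injective.injOn)).mono ?_
  rintro _ ⟨y, hy, rfl⟩
  have := hy.joined.shift x
  rw [sub_self] at this
  exact this.connectedIn (by simpa [shiftConfig] using hy.mem)

lemma measure_hasInfiniteCluster_eq_zero {p : ℝ} {μ : Measure (Site → Bool)}
    (hμ : IsBernoulli p μ) (h : theta adjZ2 μ = 0) :
    μ {η | HasInfiniteCluster adjZ2 (toConfig η)} = 0 := by
  have := hμ.1
  have h₀ : μ {η | InInfiniteCluster adjZ2 (toConfig η) 0} = 0 :=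
    (ENNReal.toReal_eq_zero_iff _).1 h |>.resolve_right (measure_ne_top _ _)
  refine measure_mono_null (t := ⋃ x, translate x ⁻¹'
    {η | InInfiniteCluster adjZ2 (toConfig η) 0}) ?_ (measure_iUnion_null fun x => ?_)
  · rintro η ⟨x, hx⟩
    exact Set.mem_iUnion.2 ⟨x, inInfiniteCluster_shiftConfig hx⟩
  · rw [← MeasurableEquiv.map_apply, hμ.map_translate, h₀]

lemma theta_le_thetaEnh (φ : Config → Config) (μ ν : Measure (Site → Bool))
    [IsProbabilityMeasure μ] [IsProbabilityMeasure ν] :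
    theta adjZ2 μ ≤ thetaEnh adjZ2 φ μ ν := by
  refine ENNReal.toReal_mono (measure_ne_top _ _) ?_
  calc μ {η | InInfiniteCluster adjZ2 (toConfig η) 0}
      = (μ.prod ν) ({η | InInfiniteCluster adjZ2 (toConfig η) 0} ×ˢ Set.univ) := by
        rw [Measure.prod_prod, measure_univ, mul_one]
    _ ≤ _ := measure_mono fun ηα h =>
        h.1.mono fun y hy => ConnectedIn.mono Set.subset_union_left hy

lemma thetaEnh_eq_zero (hφ : IsEnhancement R₀ φ) (hmono : Monotonic φ)
    (hness : ¬ Essential adjZ2 φ) {p : ℝ} {μ ν : Measure (Site → Bool)} (hμ : IsBernoulli p μ)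
    [SFinite ν] (h : theta adjZ2 μ = 0) : thetaEnh adjZ2 φ μ ν = 0 := by
  rw [thetaEnh, measure_mono_null (t := {η | HasInfiniteCluster adjZ2 (toConfig η)} ×ˢ Set.univ),
    ENNReal.toReal_zero]
  · intro ηα h
    exact ⟨by_contra fun hno =>
      not_inInfiniteCluster_enhanced hφ hmono hness hno ηα.2 h, trivial⟩
  · rw [Measure.prod_prod, measure_hasInfiniteCluster_eq_zero hμ h, zero_mul]

/-- a monotonic nonessential enhancement cannot create an infinite
cluster where there was none (`θ(p) = 0 → θ(p,s) = 0`), and consequently it leaves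
the critical point unchanged. -/
theorem nonessential_leaves_pc_unchanged
    (P : ℝ → Measure (Site → Bool))
    (hP : ∀ p ∈ Icc (0:ℝ) 1, IsBernoulli p (P p))
    (R₀ : ℝ) (φ : Config → Config) (hφ : IsEnhancement R₀ φ)
    (hmono : Monotonic φ) (hness : ¬ Essential adjZ2 φ) :
    (∀ s ∈ Icc (0:ℝ) 1, ∀ p ∈ Icc (0:ℝ) 1,
        theta adjZ2 (P p) = 0 → thetaEnh adjZ2 φ (P p) (P s) = 0) ∧
      ∀ s ∈ Icc (0:ℝ) 1,
        sSup {p | p ∈ Icc (0:ℝ) 1 ∧ thetaEnh adjZ2 φ (P p) (P s) = 0} = pcOf adjZ2 P := by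
  have key : ∀ s ∈ Icc (0:ℝ) 1, ∀ p ∈ Icc (0:ℝ) 1,
      theta adjZ2 (P p) = 0 → thetaEnh adjZ2 φ (P p) (P s) = 0 := by
    intro s hs p hp h
    have := (hP s hs).1
    exact thetaEnh_eq_zero hφ hmono hness (hP p hp) h
  refine ⟨key, fun s hs => congrArg sSup (Set.ext fun p => and_congr_right fun hp => ⟨fun h => ?_,
    key s hs p hp⟩)⟩
  have := (hP s hs).1
  have := (hP p hp).1
  exact le_antisymm (h ▸ theta_le_thetaEnh φ (P p) (P s)) ENNReal.toReal_nonneg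

end PercEnh
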